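/- arXiv:1804.06036 — 2 statements merged into one kernel-verified Lean document; each statement's English description precedes it below -/
import Mathlib

section
/- Let G be a connected almost cubic simple graph (every vertex has degree 3 except at most one) that admits a (1,2)-decomposition, and let L be an incidence 6-list assignment of G. Then every pendent edge of G (an edge incident with a vertex of degree 1) is freely L-choosable. -/
/-- `(v, e)` is an incidence of the simple graph `G` when `e` is an edge of `G` and `v` is an
endpoint of `e`. -/
def IsIncidence {V : Type*} (G : SimpleGraph V) (v : V) (e : Sym2 V) : Prop :=
  e ∈ G.edgeSet ∧ v ∈ e

/-- Two incidences `(v, e)` and `(w, f)` are adjacent if `v = w`, or `e = f`, or the edge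
joining `v` and `w` is `e` or `f`. -/
def IncAdj {V : Type*} (v : V) (e : Sym2 V) (w : V) (f : Sym2 V) : Prop :=
  v = w ∨ e = f ∨ s(v, w) = e ∨ s(v, w) = f

/-- `φ` is an incidence coloring of `G` choosing colors from the list assignment `L`. -/
def IsIncListColoring {V : Type*} (G : SimpleGraph V) (L : V × Sym2 V → Finset ℕ)
    (φ : V × Sym2 V → ℕ) : Prop :=
  (∀ v e, IsIncidence G v e → φ (v, e) ∈ L (v, e)) ∧
  (∀ v e w f, IsIncidence G v e → IsIncidence G w f → (v, e) ≠ (w, f) → IncAdj v e w f →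
    φ (v, e) ≠ φ (w, f))

/-- `G` is incidence `k`-choosable: for every assignment of lists of `k` colors to the
incidences of `G` there is an incidence coloring choosing colors from the lists. -/
def IncChoosable {V : Type*} (G : SimpleGraph V) (k : ℕ) : Prop :=
  ∀ L : V × Sym2 V → Finset ℕ, (∀ v e, IsIncidence G v e → (L (v, e)).card = k) →
    ∃ φ, IsIncListColoring G L φ

/-- The incidence choice number of `G`: the least `k` such that `G` is incidence
`k`-choosable. -/
noncomputable def incChoiceNumber {V : Type*} (G : SimpleGraph V) : ℕ :=
  sInf {k | IncChoosable G k}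

/-- The degree of a vertex of a simple graph (number of neighbors). -/
noncomputable def vdeg {V : Type*} (G : SimpleGraph V) (v : V) : ℕ :=
  (G.neighborSet v).ncard

/-- A (1,2)-decomposition of `G`: a bipartition `(E₁, E₂)` of the edge set such that `E₁`
induces a 1-factor (every vertex lies on exactly one edge of `E₁`) and `E₂` induces a
2-regular graph (every vertex lies on exactly two edges of `E₂` or on none). -/
def IsOneTwoDecomposition {V : Type*} (G : SimpleGraph V) (E₁ E₂ : Set (Sym2 V)) : Prop :=
  E₁ ∪ E₂ = G.edgeSet ∧ Disjoint E₁ E₂ ∧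
  (∀ v : V, {e | e ∈ E₁ ∧ v ∈ e}.ncard = 1) ∧
  (∀ v : V, {e | e ∈ E₂ ∧ v ∈ e}.ncard = 0 ∨ {e | e ∈ E₂ ∧ v ∈ e}.ncard = 2)

/-- The edge `uv` is freely `L`-choosable: for any two distinct colors `c₁ ∈ L(u, uv)` and
`c₂ ∈ L(v, uv)` there is an incidence `L`-coloring of `G` assigning `c₁` to `(u, uv)` and
`c₂` to `(v, uv)`. -/
def FreelyLChoosable {V : Type*} (G : SimpleGraph V) (L : V × Sym2 V → Finset ℕ)
    (u v : V) : Prop :=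
  ∀ c₁ ∈ L (u, s(u, v)), ∀ c₂ ∈ L (v, s(u, v)), c₁ ≠ c₂ →
    ∃ φ, IsIncListColoring G L φ ∧ φ (u, s(u, v)) = c₁ ∧ φ (v, s(u, v)) = c₂

theorem pick1 (A : Finset ℕ) (h : 2 ≤ A.card) (x : ℕ) : ∃ y ∈ A, y ≠ x := by
  have : ({x} : Finset ℕ).card < A.card := by simp; omega
  obtain ⟨y, hy, hx⟩ := Finset.exists_mem_notMem_of_card_lt_card this
  exact ⟨y, hy, by simpa using hx⟩

theorem pick0 (A : Finset ℕ) (h : 1 ≤ A.card) : ∃ y, y ∈ A :=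
  Finset.card_pos.mp h

theorem pick2 (A : Finset ℕ) (h : 3 ≤ A.card) (x z : ℕ) : ∃ y ∈ A, y ≠ x ∧ y ≠ z := by
  have : ({x, z} : Finset ℕ).card < A.card := lt_of_le_of_lt Finset.card_le_two (by omega)
  obtain ⟨y, hy, hx⟩ := Finset.exists_mem_notMem_of_card_lt_card this
  refine ⟨y, hy, ?_⟩
  simpa using hx

theorem card_del (A : Finset ℕ) (x k : ℕ) (h : k + 1 ≤ A.card) : k ≤ (A \ {x}).card := by
  have := Finset.le_card_sdiff {x} A
  simp at this; omega

theorem window (R0 R1 R2 R3 R4 : Finset ℕ) (h0 : 2 ≤ R0.card) (h1 : 3 ≤ R1.card)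
    (h2 : 3 ≤ R2.card) (h3 : 2 ≤ R3.card) (h4 : 2 ≤ R4.card) :
    ∃ a0 ∈ R0, ∃ a1 ∈ R1, ∃ a2 ∈ R2, ∃ a3 ∈ R3, ∃ a4 ∈ R4,
      a0 ≠ a1 ∧ a0 ≠ a2 ∧ a1 ≠ a2 ∧ a1 ≠ a3 ∧ a2 ≠ a3 ∧ a2 ≠ a4 ∧ a3 ≠ a4 := by
  obtain ⟨R, hR, hRc⟩ := Finset.exists_subset_card_eq h1
  by_cases hA : ∃ c, c ∈ R0 ∧ c ∈ R3
  · obtain ⟨c, hc0, hc3⟩ := hA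
    obtain ⟨a4, m4, n4⟩ := pick1 R4 h4 c
    obtain ⟨a2, m2, n2, n2'⟩ := pick2 R2 h2 c a4
    obtain ⟨a1, m1, n1, n1'⟩ := pick2 R1 h1 c a2
    exact ⟨c, hc0, a1, m1, a2, m2, c, hc3, a4, m4, by grind⟩
  by_cases hB : ∃ t ∈ R4, t ∉ R3
  · obtain ⟨t, ht, ht3⟩ := hB
    have hd : Disjoint R0 R3 := by
      rw [Finset.disjoint_left]; intro x hx hx'; exact hA ⟨x, hx, hx'⟩
    have : R.card < (R0 ∪ R3).card := by
      rw [Finset.card_union_of_disjoint hd]; omega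
    obtain ⟨d, hd', hdR⟩ := Finset.exists_mem_notMem_of_card_lt_card this
    obtain ⟨a2, m2, n2, n2'⟩ := pick2 R2 h2 t d
    rcases Finset.mem_union.mp hd' with hd0 | hd3
    · obtain ⟨a3, m3, n3⟩ := pick1 R3 h3 a2
      obtain ⟨a1, m1, n1, n1'⟩ := pick2 R (by omega) a2 a3
      exact ⟨d, hd0, a1, hR m1, a2, m2, a3, m3, t, ht, by grind⟩
    · obtain ⟨a0, m0, n0⟩ := pick1 R0 h0 a2
      obtain ⟨a1, m1, n1, n1'⟩ := pick2 R (by omega) a2 a0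
      exact ⟨a0, m0, a1, hR m1, a2, m2, d, hd3, t, ht, by grind⟩
  · push Not at hB
    obtain ⟨α, hα⟩ := pick0 R4 (by omega)
    obtain ⟨β, hβ, hne⟩ := pick1 R4 h4 α
    obtain ⟨a2, m2, n2, n2'⟩ := pick2 R2 h2 α β
    obtain ⟨a0, m0, n0⟩ := pick1 R0 h0 a2
    obtain ⟨a1, m1, n1, n1'⟩ := pick2 R1 h1 a2 a0
    by_cases h : a1 = α
    · exact ⟨a0, m0, a1, m1, a2, m2, β, hB _ hβ, α, hα, by grind⟩
    · exact ⟨a0, m0, a1, m1, a2, m2, α, hB _ hα, β, hβ, by grind⟩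

theorem octa (A : Fin 6 → Finset ℕ) (h3 : ∀ i, 3 ≤ (A i).card) (h0 : 4 ≤ (A 0).card)
    (h1 : 4 ≤ (A 1).card) : ∃ a : Fin 6 → ℕ, (∀ i, a i ∈ A i) ∧
      ∀ i j, j ≠ i → j ≠ i + 3 → a i ≠ a j := by
  have key : ∀ i j : Fin 6, j ≠ i → j ≠ i + 3 → 
      (i, j) ∈ ([(0,1),(0,2),(0,4),(0,5),(1,2),(1,3),(1,5),(2,3),(2,4),(3,4),(3,5),(4,5)] : List (Fin 6 × Fin 6))
      ∨ (j, i) ∈ ([(0,1),(0,2),(0,4),(0,5),(1,2),(1,3),(1,5),(2,3),(2,4),(3,4),(3,5),(4,5)] : List (Fin 6 × Fin 6)) := by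
    decide
  have fin : ∀ a0 ∈ A 0, ∀ a1 ∈ A 1, ∀ a2 ∈ A 2, ∀ a3 ∈ A 3, ∀ a4 ∈ A 4, ∀ a5 ∈ A 5,
      a0 ≠ a1 → a0 ≠ a2 → a0 ≠ a4 → a0 ≠ a5 → a1 ≠ a2 → a1 ≠ a3 → a1 ≠ a5 → a2 ≠ a3 →
      a2 ≠ a4 → a3 ≠ a4 → a3 ≠ a5 → a4 ≠ a5 → ∃ a : Fin 6 → ℕ, (∀ i, a i ∈ A i) ∧
      ∀ i j, j ≠ i → j ≠ i + 3 → a i ≠ a j := by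
    intro a0 m0 a1 m1 a2 m2 a3 m3 a4 m4 a5 m5 h01 h02 h04 h05 h12 h13 h15 h23 h24 h34 h35 h45
    refine ⟨![a0, a1, a2, a3, a4, a5], ?_, ?_⟩
    · intro i; fin_cases i <;> assumption
    · have : ∀ i j, (i, j) ∈ ([(0,1),(0,2),(0,4),(0,5),(1,2),(1,3),(1,5),(2,3),(2,4),(3,4),(3,5),(4,5)] : List (Fin 6 × Fin 6)) → (![a0, a1, a2, a3, a4, a5] : Fin 6 → ℕ) i ≠ ![a0, a1, a2, a3, a4, a5] j := by
        intro i j hij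
        simp only [List.mem_cons, Prod.mk.injEq, List.not_mem_nil, or_false] at hij
        rcases hij with h|h|h|h|h|h|h|h|h|h|h|h <;> obtain ⟨rfl, rfl⟩ := h <;> assumption
      intro i j h h'
      rcases key i j h h' with h | h
      · exact this _ _ h
      · exact (this _ _ h).symm
  by_cases c25 : ∃ c, c ∈ A 2 ∧ c ∈ A 5
  · obtain ⟨c, m2, m5⟩ := c25
    obtain ⟨a3, m3, n3⟩ := pick1 (A 3) (by have := h3 3; omega) c
    obtain ⟨a4, m4, n4, n4'⟩ := pick2 (A 4) (h3 4) c a3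
    obtain ⟨a1, m1, n1, n1'⟩ := pick2 (A 1) (h3 1) c a3
    obtain ⟨a0, m0, n0, n0'⟩ := pick2 (A 0 \ {c}) (card_del _ _ _ h0) a1 a4
    simp at m0
    apply fin a0 m0.1 a1 m1 c m2 a3 m3 a4 m4 c m5 <;> grind
  by_cases c03 : ∃ c, c ∈ A 0 ∧ c ∈ A 3
  · obtain ⟨c, m0, m3⟩ := c03
    obtain ⟨a4, m4, n4⟩ := pick1 (A 4) (by have := h3 4; omega) c
    obtain ⟨a2, m2, n2, n2'⟩ := pick2 (A 2) (h3 2) c a4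
    obtain ⟨a5, m5, n5, n5'⟩ := pick2 (A 5) (h3 5) c a4
    obtain ⟨a1, m1, n1, n1'⟩ := pick2 (A 1 \ {c}) (card_del _ _ _ h1) a2 a5
    simp at m1
    apply fin c m0 a1 m1.1 a2 m2 c m3 a4 m4 a5 m5 <;> grind
  by_cases c14 : ∃ c, c ∈ A 1 ∧ c ∈ A 4
  · obtain ⟨c, m1, m4⟩ := c14
    obtain ⟨a3, m3, n3⟩ := pick1 (A 3) (by have := h3 3; omega) c
    obtain ⟨a2, m2, n2, n2'⟩ := pick2 (A 2) (h3 2) c a3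
    obtain ⟨a5, m5, n5, n5'⟩ := pick2 (A 5) (h3 5) c a3
    obtain ⟨a0, m0, n0, n0'⟩ := pick2 (A 0 \ {c}) (card_del _ _ _ h0) a2 a5
    simp at m0
    apply fin a0 m0.1 c m1 a2 m2 a3 m3 c m4 a5 m5 <;> grind
  have hdis : ∀ i : Fin 6, Disjoint (A i) (A (i + 3)) := by
    intro i
    rw [Finset.disjoint_left]
    intro x hx hx'
    fin_cases i
    · exact c03 ⟨x, hx, hx'⟩
    · exact c14 ⟨x, hx, hx'⟩
    · exact c25 ⟨x, hx, hx'⟩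
    · exact c03 ⟨x, hx', hx⟩
    · exact c14 ⟨x, hx', hx⟩
    · exact c25 ⟨x, hx', hx⟩
  have dec : ∀ s : Finset (Fin 6), s.card ≤ 3 ∨ ∃ i, i ∈ s ∧ i + 3 ∈ s := by decide
  obtain ⟨a, ha, ham⟩ := (Finset.all_card_le_biUnion_card_iff_exists_injective A).mp (by
    intro s
    rcases dec s with h | ⟨i, hi, hi'⟩
    · rcases s.eq_empty_or_nonempty with rfl | ⟨i, hi⟩
      · simp
      · exact h.trans ((h3 i).trans (Finset.card_le_card (Finset.subset_biUnion_of_mem A hi)))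
    · have h6 : s.card ≤ 6 := by simpa using Finset.card_le_univ s
      have : (A i ∪ A (i + 3)).card ≤ (s.biUnion A).card :=
        Finset.card_le_card (Finset.union_subset (Finset.subset_biUnion_of_mem A hi)
          (Finset.subset_biUnion_of_mem A hi'))
      rw [Finset.card_union_of_disjoint (hdis i)] at this
      have := h3 i
      have := h3 (i + 3)
      omega)
  exact ⟨a, ham, fun i j h _ h' => h (ha h').symm⟩

/-- greedy colouring of a path square -/
theorem greedy (A : ℕ → Finset ℕ) (m : ℕ) (h3 : ∀ k < m, 3 ≤ (A k).card) :
    ∃ a : ℕ → ℕ, (∀ k < m, a k ∈ A k) ∧ (∀ k, k + 1 < m → a k ≠ a (k + 1)) ∧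
      (∀ k, k + 2 < m → a k ≠ a (k + 2)) := by
  induction m with
  | zero => exact ⟨fun _ => 0, by simp⟩
  | succ m ih =>
    obtain ⟨a, ha, ha1, ha2⟩ := ih (fun k hk => h3 k (by omega))
    obtain ⟨y, hy, n1, n2⟩ := pick2 (A m) (h3 m (by omega)) (a (m - 1)) (a (m - 2))
    refine ⟨fun k => if k = m then y else a k, ?_, ?_, ?_⟩ <;> intro k hk <;> grind

theorem cyc_color (n : ℕ) (hn : 3 ≤ n) (A : ℕ → Finset ℕ) (h3 : ∀ k < 2 * n, 3 ≤ (A k).card)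
    (h0 : 4 ≤ (A 0).card) (h1 : 4 ≤ (A 1).card) (h4 : 4 ≤ n → 4 ≤ (A 4).card) :
    ∃ a : ℕ → ℕ, (∀ k < 2 * n, a k ∈ A k) ∧
      ∀ k < 2 * n, a k ≠ a ((k + 1) % (2 * n)) ∧ a k ≠ a ((k + 2) % (2 * n)) := by
  rcases Nat.lt_or_ge n 4 with h | h
  · obtain rfl : n = 3 := by omega
    obtain ⟨a, ha, hne⟩ := octa (fun i => A i.val) (fun i => h3 _ (by omega)) h0 h1
    refine ⟨fun k => a (Fin.ofNat 6 k), ?_, ?_⟩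
    · intro k hk
      have := ha (Fin.ofNat 6 k)
      simpa [Nat.mod_eq_of_lt hk] using this
    · intro k hk
      constructor
      · apply hne
        · clear * - hk; interval_cases k <;> decide
        · clear * - hk; interval_cases k <;> decide
      · apply hne
        · clear * - hk; interval_cases k <;> decide
        · clear * - hk; interval_cases k <;> decide
  · obtain ⟨b, hb, hb1, hb2⟩ := greedy (fun k => A (k + 5)) (2 * n - 5) (fun k hk => h3 _ (by omega))
    specialize h4 h
    obtain ⟨a0, m0, a1, m1, a2, m2, a3, m3, a4, m4, e⟩ := window
      ((A 0 \ {b (2 * n - 6)}) \ {b (2 * n - 7)}) (A 1 \ {b (2 * n - 6)}) (A 2)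
      (A 3 \ {b 0}) ((A 4 \ {b 0}) \ {b 1})
      (card_del _ _ _ (card_del _ _ _ h0)) (card_del _ _ _ h1) (h3 2 (by omega))
      (card_del _ _ _ (h3 3 (by omega))) (card_del _ _ _ (card_del _ _ _ h4))
    obtain ⟨e01, e02, e12, e13, e23, e24, e34⟩ := e
    simp only [Finset.mem_sdiff, Finset.mem_singleton] at m0 m1 m3 m4
    let a : ℕ → ℕ := fun k => if k = 0 then a0 else if k = 1 then a1 else if k = 2 then a2 else
      if k = 3 then a3 else if k = 4 then a4 else b (k - 5)
    have H5 : ∀ k, 5 ≤ k → a k = b (k - 5) := by intro k hk; grind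
    have A0 : a 0 = a0 := rfl
    have A1 : a 1 = a1 := rfl
    have A2 : a 2 = a2 := rfl
    have A3 : a 3 = a3 := rfl
    have A4 : a 4 = a4 := rfl
    refine ⟨a, ?_, ?_⟩
    · intro k hk
      rcases Nat.lt_or_ge k 5 with h5 | h5
      · interval_cases k <;> grind
      · rw [H5 k h5]
        have := hb (k - 5) (by omega)
        simpa [Nat.sub_add_cancel h5] using this
    · intro k hk
      have E1 : k + 1 < 2 * n → (k + 1) % (2 * n) = k + 1 := Nat.mod_eq_of_lt
      have E2 : k + 2 < 2 * n → (k + 2) % (2 * n) = k + 2 := Nat.mod_eq_of_lt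
      rcases Nat.lt_or_ge k 5 with h5 | h5
      · rw [E1 (by omega), E2 (by omega)]
        have H50 : a 5 = b 0 := H5 5 (by omega)
        have H51 : a 6 = b 1 := H5 6 (by omega)
        interval_cases k <;> constructor <;> grind
      · rw [H5 k h5]
        constructor
        · by_cases hk1 : k + 1 < 2 * n
          · rw [E1 hk1, H5 _ (by omega)]
            have := hb1 (k - 5) (by omega)
            rwa [show k - 5 + 1 = k + 1 - 5 by omega] at this
          · obtain rfl : k = 2 * n - 1 := by omega
            rw [show 2 * n - 1 + 1 = 2 * n by omega, Nat.mod_self, A0]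
            have := m0.1.2
            rw [show 2 * n - 1 - 5 = 2 * n - 6 by omega]
            exact fun h => this h.symm
        · by_cases hk1 : k + 2 < 2 * n
          · rw [E2 hk1, H5 _ (by omega)]
            have := hb2 (k - 5) (by omega)
            rwa [show k - 5 + 2 = k + 2 - 5 by omega] at this
          · have : k = 2 * n - 1 ∨ k = 2 * n - 2 := by omega
            rcases this with rfl | rfl
            · rw [show 2 * n - 1 + 2 = 1 + 2 * n by omega, Nat.add_mod_right,
                Nat.mod_eq_of_lt (by omega), A1, show 2 * n - 1 - 5 = 2 * n - 6 by omega]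
              exact fun h => m1.2 h.symm
            · rw [show 2 * n - 2 + 2 = 2 * n by omega, Nat.mod_self, A0,
                show 2 * n - 2 - 5 = 2 * n - 7 by omega]
              exact fun h => m0.2 h.symm

/-- a cycle of the 2-regular graph `H` -/
structure Cyc {V : Type*} (H : SimpleGraph V) (n : ℕ) (c : ℕ → V) : Prop where
  three : 3 ≤ n
  inj : ∀ i < n, ∀ j < n, c i = c j → i = j
  per : ∀ i, c (i % n) = c i
  adj : ∀ i, H.Adj (c i) (c (i + 1))
  nbr : ∀ i w, H.Adj (c i) w → w = c (i + 1) ∨ w = c (i + n - 1)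

theorem Cyc.eq_mod {V : Type*} {H : SimpleGraph V} {n : ℕ} {c : ℕ → V} (h : Cyc H n c)
    {i j : ℕ} (hij : i % n = j % n) : c i = c j := by
  rw [← h.per i, ← h.per j, hij]

theorem Cyc.ne {V : Type*} {H : SimpleGraph V} {n : ℕ} {c : ℕ → V} (h : Cyc H n c)
    (i : ℕ) : c (i + 1) ≠ c (i + n - 1) := by
  have h3 := h.three
  intro he
  rw [← h.per (i + 1), ← h.per (i + n - 1)] at he
  have := h.inj _ (Nat.mod_lt _ (by omega)) _ (Nat.mod_lt _ (by omega)) he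
  have h2 : i + 1 ≡ (i + 1) + (n - 2) [MOD n] := by
    rw [show (i + 1) + (n - 2) = i + n - 1 by omega]; exact this
  have h3 : 0 ≡ n - 2 [MOD n] := Nat.ModEq.add_left_cancel' (i + 1) h2
  have := Nat.le_of_dvd (by omega) ((Nat.modEq_zero_iff_dvd).mp h3.symm)
  omega

theorem exists_cyc {V : Type*} [Fintype V] (H : SimpleGraph V) (hH : H.IsCycles) (x : V)
    (hx : (H.neighborSet x).Nonempty) : ∃ n c, Cyc H n c ∧ c 0 = x := by
  obtain ⟨p, hp, -⟩ := hH.exists_cycle_toSubgraph_verts_eq_connectedComponentSupp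
    (c := H.connectedComponentMk x) (by simp) hx
  have h3 := hp.three_le_length
  have hinj : ∀ i < p.length, ∀ j < p.length, p.getVert i = p.getVert j → i = j := by
    intro i hi j hj h
    exact hp.getVert_injOn' (by simp; omega) (by simp; omega) h
  have hadj : ∀ i, H.Adj (p.getVert (i % p.length)) (p.getVert ((i + 1) % p.length)) := by
    intro i
    have hlt := Nat.mod_lt i (show p.length > 0 by omega)
    have := p.adj_getVert_succ hlt
    by_cases h : i % p.length + 1 = p.length
    · have e : (i + 1) % p.length = 0 := by
        rw [Nat.add_mod, Nat.mod_eq_of_lt (show 1 < p.length by omega), h, Nat.mod_self]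
      rw [h, p.getVert_length] at this
      rw [e, p.getVert_zero]; exact this
    · have e : (i + 1) % p.length = i % p.length + 1 := by
        rw [Nat.add_mod, Nat.mod_eq_of_lt (show 1 < p.length by omega), 
          Nat.mod_eq_of_lt (by omega)]
      rw [e]; exact this
  have pre : ∀ i, p.getVert ((i + 1) % p.length) ≠ p.getVert ((i + p.length - 1) % p.length) := by
    intro i he
    have := hinj _ (Nat.mod_lt _ (by omega)) _ (Nat.mod_lt _ (by omega)) he
    have h2 : i + 1 ≡ (i + 1) + (p.length - 2) [MOD p.length] := by
      rw [show (i + 1) + (p.length - 2) = i + p.length - 1 by omega]; exact this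
    have h3 : 0 ≡ p.length - 2 [MOD p.length] := Nat.ModEq.add_left_cancel' (i + 1) h2
    have := Nat.le_of_dvd (by omega) ((Nat.modEq_zero_iff_dvd).mp h3.symm)
    omega
  refine ⟨p.length, fun i => p.getVert (i % p.length), ⟨h3, ?_, ?_, hadj, ?_⟩, ?_⟩
  · intro i hi j hj h
    simp only [Nat.mod_eq_of_lt hi, Nat.mod_eq_of_lt hj] at h
    exact hinj i hi j hj h
  · intro i; simp
  · intro i w hw
    have hb : H.Adj (p.getVert (i % p.length)) (p.getVert ((i + p.length - 1) % p.length)) := by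
      have := (hadj (i + p.length - 1)).symm
      rwa [show i + p.length - 1 + 1 = i + p.length by omega, Nat.add_mod_right] at this
    have hc := hH (v := p.getVert (i % p.length)) ⟨_, hw⟩
    have hs : ({p.getVert ((i + 1) % p.length), p.getVert ((i + p.length - 1) % p.length)} : Set V)
        ⊆ H.neighborSet (p.getVert (i % p.length)) := by
      intro z hz
      rcases hz with rfl | hz
      · exact hadj i
      · rw [hz]; exact hb
    have := Set.eq_of_subset_of_ncard_le hs (by rw [hc, Set.ncard_pair (pre i)]) (Set.toFinite _)
    have hw' : w ∈ H.neighborSet (p.getVert (i % p.length)) := hw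
    rw [← this] at hw'
    simpa using hw'
  · simp

theorem cyc_psi {V : Type*} (H : SimpleGraph V) (n : ℕ) (c : ℕ → V) (hc : Cyc H n c)
    (Λ : V → V → Finset ℕ) (h3 : ∀ x y, H.Adj x y → 3 ≤ (Λ x y).card)
    (s0 : 4 ≤ (Λ (c 0) (c (n - 1))).card) (s1 : 4 ≤ (Λ (c 0) (c 1)).card)
    (s4 : 4 ≤ n → 4 ≤ (Λ (c 2) (c 1)).card) :
    ∃ ψ : V → V → ℕ, ∀ i y, H.Adj (c i) y → ψ (c i) y ∈ Λ (c i) y ∧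
      (∀ w, H.Adj (c i) w → w ≠ y → ψ (c i) w ≠ ψ (c i) y) ∧
      (∀ w, H.Adj y w → ψ (c i) y ≠ ψ y w) := by
  classical
  have hn := hc.three
  have hback : ∀ i, H.Adj (c i) (c (i + n - 1)) := by
    intro i
    have := (hc.adj (i + n - 1)).symm
    rwa [hc.eq_mod (i := i + n - 1 + 1) (j := i)
      (by rw [show i + n - 1 + 1 = i + n by omega, Nat.add_mod_right])] at this
  obtain ⟨a, haA, hne⟩ := cyc_color n hn
    (fun k => if k % 2 = 1 then Λ (c (k / 2)) (c (k / 2 + 1)) else Λ (c (k / 2)) (c (k / 2 + n - 1)))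
    (by
      intro k hk

      split_ifs
      · exact h3 _ _ (hc.adj _)
      · exact h3 _ _ (hback _)) (by simpa using s0) (by simpa using s1)
    (by
      intro h
      have := s4 h
      rw [hc.eq_mod (i := 1) (j := 2 + n - 1)
        (by rw [show 2 + n - 1 = 1 + n by omega, Nat.add_mod_right])] at this
      simpa using this)
  have hex : ∀ x, ∃ j, (∃ i, c i = x) → j < n ∧ c j = x := by
    intro x
    by_cases h : ∃ i, c i = x
    · obtain ⟨i, hi⟩ := h
      exact ⟨i % n, fun _ => ⟨Nat.mod_lt _ (by omega), by rw [hc.per, hi]⟩⟩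
    · exact ⟨0, fun h' => absurd h' h⟩
  choose ix hix using hex
  have ixc : ∀ i < n, ix (c i) = i := by
    intro i hi
    have := hix (c i) ⟨i, rfl⟩
    exact hc.inj _ this.1 _ hi this.2
  let ψ : V → V → ℕ := fun x y => if y = c (ix x + 1) then a (2 * ix x + 1) else a (2 * ix x)
  have pf : ∀ i < n, ψ (c i) (c (i + 1)) = a (2 * i + 1) := by
    intro i hi
    simp only [ψ, ixc i hi, if_true]
  have pb : ∀ i < n, ψ (c i) (c (i + n - 1)) = a (2 * i) := by
    intro i hi
    simp only [ψ, ixc i hi]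
    rw [if_neg (hc.ne i).symm]
  have main : ∀ i < n, ∀ y, H.Adj (c i) y → ψ (c i) y ∈ Λ (c i) y ∧
      (∀ w, H.Adj (c i) w → w ≠ y → ψ (c i) w ≠ ψ (c i) y) ∧
      (∀ w, H.Adj y w → ψ (c i) y ≠ ψ y w) := by
    intro i hi y hy
    have e01 : a (2 * i) ≠ a (2 * i + 1) := by
      have := (hne (2 * i) (by omega)).1
      rwa [Nat.mod_eq_of_lt (show 2 * i + 1 < 2 * n by omega)] at this
    rcases hc.nbr i y hy with rfl | rfl
    · refine ⟨?_, ?_, ?_⟩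
      · rw [pf i hi]
        have := haA (2 * i + 1) (by omega)
        rw [if_pos (by omega), show (2 * i + 1) / 2 = i by omega] at this
        exact this
      · intro w hw hwy
        rcases hc.nbr i w hw with rfl | rfl
        · exact absurd rfl hwy
        · rw [pf i hi, pb i hi]; exact e01
      · intro w hw
        rw [pf i hi]
        obtain ⟨j, hj, hij, hjm⟩ : ∃ j < n, c (i + 1) = c j ∧ 2 * j = (2 * i + 2) % (2 * n) :=
          ⟨(i + 1) % n, Nat.mod_lt _ (by omega), (hc.per _).symm, by
            rw [← Nat.mul_mod_mul_left]; rfl⟩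
        rw [hij] at hw ⊢
        have hh := hne (2 * i + 1) (by omega)
        rcases hc.nbr j w hw with rfl | rfl
        · rw [pf j hj]
          have e : (2 * i + 1 + 2) % (2 * n) = 2 * j + 1 := by
            rw [show 2 * i + 1 + 2 = (2 * i + 2) + 1 by omega, Nat.add_mod, ← hjm,
              Nat.mod_eq_of_lt (show 1 < 2 * n by omega), Nat.mod_eq_of_lt (by omega)]
          rw [← e]; exact hh.2
        · rw [pb j hj, hjm]; exact hh.1
    · refine ⟨?_, ?_, ?_⟩
      · rw [pb i hi]
        have := haA (2 * i) (by omega)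
        rw [if_neg (by omega), show (2 * i) / 2 = i by omega] at this
        exact this
      · intro w hw hwy
        rcases hc.nbr i w hw with rfl | rfl
        · rw [pf i hi, pb i hi]; exact e01.symm
        · exact absurd rfl hwy
      · intro w hw
        rw [pb i hi]
        obtain ⟨j, hj, hij, hjm⟩ : ∃ j < n, c (i + n - 1) = c j ∧ 2 * i = (2 * j + 2) % (2 * n) := by
          refine ⟨(i + n - 1) % n, Nat.mod_lt _ (by omega), (hc.per _).symm, ?_⟩
          rw [← Nat.mul_mod_mul_left, Nat.mod_add_mod, show 2 * (i + n - 1) + 2 = 2 * i + 2 * n by omega,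
            Nat.add_mod_right, Nat.mod_eq_of_lt (by omega)]
        rw [hij] at hw ⊢
        rcases hc.nbr j w hw with rfl | rfl
        · rw [pf j hj, hjm]
          exact (hne (2 * j + 1) (by omega)).1.symm
        · rw [pb j hj, hjm]
          exact (hne (2 * j) (by omega)).2.symm
  refine ⟨ψ, ?_⟩
  intro i y hy
  rw [← hc.per i] at hy ⊢
  exact main _ (Nat.mod_lt _ (by omega)) y hy

/-- list left for the arc `x → y` after colouring matching arcs by `P` -/
def lam {V : Type*} (ℓ : V → V → Finset ℕ) (m : V → V) (P : V → ℕ) (x y : V) : Finset ℕ :=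
  ℓ x y \ {P x, P (m x), P y}

/-- surplus conditions -/
def Surp {V : Type*} (ℓ : V → V → Finset ℕ) (m : V → V) (P : V → ℕ) (n : ℕ) (c : ℕ → V) : Prop :=
  4 ≤ (lam ℓ m P (c 0) (c (n - 1))).card ∧ 4 ≤ (lam ℓ m P (c 0) (c 1)).card ∧
    (4 ≤ n → 4 ≤ (lam ℓ m P (c 2) (c 1)).card)

/-- proper partial colouring of matching arcs -/
def PropM {V : Type*} (ℓ : V → V → Finset ℕ) (m : V → V) (T : Set V) (P : V → ℕ) : Prop :=
  (∀ x ∈ T, P x ∈ ℓ x (m x)) ∧ ∀ x ∈ T, m x ∈ T → P x ≠ P (m x)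

theorem PropM.ins {V : Type*} {ℓ : V → V → Finset ℕ} {m : V → V} {T : Set V} {P : V → ℕ}
    (hP : PropM ℓ m T P) (hm : ∀ x, m (m x) = x) (hm' : ∀ x, m x ≠ x) (z : V) (hz : z ∉ T) (col : ℕ)
    (h1 : col ∈ ℓ z (m z)) (h2 : m z ∈ T → col ≠ P (m z)) :
    ∃ P', PropM ℓ m (insert z T) P' ∧ P' z = col ∧ ∀ x ∈ T, P' x = P x := by
  classical
  have hne : ∀ x ∈ T, x ≠ z := fun x hx h => hz (h ▸ hx)
  refine ⟨Function.update P z col, ⟨?_, ?_⟩, by simp, ?_⟩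
  · rintro x (rfl | hx)
    · simpa using h1
    · simpa [Function.update_of_ne (hne x hx)] using hP.1 x hx
  · rintro x (rfl | hx) hmx
    · rcases hmx with h | h
      · exact absurd h (hm' _)
      · simpa [Function.update_of_ne (hm' x)] using h2 h
    · rw [Function.update_of_ne (hne x hx)]
      rcases hmx with h | h
      · rw [h, Function.update_self]
        have hx' : x = m z := by rw [← h, hm]
        rw [hx'] at hx ⊢
        exact (h2 hx).symm
      · rw [Function.update_of_ne (hne _ h)]
        exact hP.2 x hx h
  · intro x hx
    exact Function.update_of_ne (hne x hx) _ _

/-- valid colours for `z` -/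
theorem valid_card {V : Type*} {ℓ : V → V → Finset ℕ} {m : V → V} (T : Set V) (P : V → ℕ)
    (z : V) (h6 : (ℓ z (m z)).card = 6) (X : Finset ℕ) (hX : X.card ≤ 4) :
    ∃ col ∈ ℓ z (m z), (m z ∈ T → col ≠ P (m z)) ∧ col ∉ X := by
  have : X.card < (ℓ z (m z) \ {P (m z)}).card :=
    lt_of_lt_of_le (by omega) (card_del _ _ 5 (by omega))
  obtain ⟨y, hy, hx⟩ := Finset.exists_mem_notMem_of_card_lt_card this
  simp only [Finset.mem_sdiff, Finset.mem_singleton] at hy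
  exact ⟨y, hy.1, fun _ => hy.2, hx⟩

theorem sur1 {V : Type*} {ℓ : V → V → Finset ℕ} {m : V → V} (T : Set V) (P : V → ℕ)
    (x z : V) (hx : x ∈ T) (hmx : m x ∈ T) (h6 : (ℓ z (m z)).card = 6) (h6' : (ℓ x z).card = 6) :
    ∃ col ∈ ℓ z (m z), (m z ∈ T → col ≠ P (m z)) ∧ ∀ Q : V → ℕ, (∀ x ∈ T, Q x = P x) → Q z = col →
      4 ≤ (lam ℓ m Q x z).card := by
  set X := (ℓ x z \ {P x}) \ {P (m x)} with hX
  have hX4 : 4 ≤ X.card := card_del _ _ _ (card_del _ _ _ (by omega))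
  have hl : ∀ Q : V → ℕ, (∀ x ∈ T, Q x = P x) → lam ℓ m Q x z = X \ {Q z} := by
    intro Q hQ
    rw [lam, hQ x hx, hQ _ hmx, hX]
    ext t; simp; tauto
  by_cases h : 5 ≤ X.card
  · obtain ⟨col, h1, h2, -⟩ := valid_card T P z h6 ∅ (by simp)
    refine ⟨col, h1, h2, fun Q hQ _ => ?_⟩
    rw [hl Q hQ]
    exact card_del _ _ _ h
  · obtain ⟨col, h1, h2, h3⟩ := valid_card T P z h6 X (by omega)
    refine ⟨col, h1, h2, fun Q hQ hz => ?_⟩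
    rw [hl Q hQ, hz, Finset.sdiff_singleton_eq_erase, Finset.erase_eq_of_notMem h3]
    exact hX4

theorem sur2 {V : Type*} {ℓ : V → V → Finset ℕ} {m : V → V} (T : Set V) (P : V → ℕ)
    (z y : V) (hy : y ∈ T) (h6 : (ℓ z (m z)).card = 6) (h6' : (ℓ z y).card = 6) :
    ∃ col ∈ ℓ z (m z), (m z ∈ T → col ≠ P (m z)) ∧ ∀ Q : V → ℕ, (∀ x ∈ T, Q x = P x) → Q z = col →
      4 ≤ (lam ℓ m Q z y).card := by
  by_cases hmz : m z ∈ T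
  · set X := (ℓ z y \ {P y}) \ {P (m z)} with hX
    have hX4 : 4 ≤ X.card := card_del _ _ _ (card_del _ _ _ (by omega))
    have hl : ∀ Q : V → ℕ, (∀ x ∈ T, Q x = P x) → lam ℓ m Q z y = X \ {Q z} := by
      intro Q hQ
      rw [lam, hQ y hy, hQ _ hmz, hX]
      ext t; simp; tauto
    by_cases h : 5 ≤ X.card
    · obtain ⟨col, h1, h2, -⟩ := valid_card T P z h6 ∅ (by simp)
      refine ⟨col, h1, h2, fun Q hQ _ => ?_⟩
      rw [hl Q hQ]
      exact card_del _ _ _ h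
    · obtain ⟨col, h1, h2, h3⟩ := valid_card T P z h6 X (by omega)
      refine ⟨col, h1, h2, fun Q hQ hz => ?_⟩
      rw [hl Q hQ, hz, Finset.sdiff_singleton_eq_erase, Finset.erase_eq_of_notMem h3]
      exact hX4
  · set X := (ℓ z y \ {P y}) with hX
    have hX4 : 5 ≤ X.card := card_del _ _ _ (by omega)
    have hl : ∀ Q : V → ℕ, (∀ x ∈ T, Q x = P x) → lam ℓ m Q z y = (X \ {Q z}) \ {Q (m z)} := by
      intro Q hQ
      rw [lam, hQ y hy, hX]
      ext t; simp; tauto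
    by_cases h : 6 ≤ X.card
    · obtain ⟨col, h1, h2, -⟩ := valid_card T P z h6 ∅ (by simp)
      refine ⟨col, h1, h2, fun Q hQ _ => ?_⟩
      rw [hl Q hQ]
      exact card_del _ _ _ (card_del _ _ _ h)
    · have : X.card < (ℓ z (m z)).card := by omega
      obtain ⟨col, h1, h3⟩ := Finset.exists_mem_notMem_of_card_lt_card this
      refine ⟨col, h1, fun h => absurd h hmz, fun Q hQ hz => ?_⟩
      rw [hl Q hQ, hz, Finset.sdiff_singleton_eq_erase col, Finset.erase_eq_of_notMem h3]
      exact card_del _ _ _ hX4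

theorem PropM.extend {V : Type*} [Fintype V] {ℓ : V → V → Finset ℕ} {m : V → V} 
    (hm : ∀ x, m (m x) = x) (hm' : ∀ x, m x ≠ x) (h6 : ∀ z, (ℓ z (m z)).card = 6)
    (T T' : Set V) (hT : T ⊆ T') (P : V → ℕ) (hP : PropM ℓ m T P) :
    ∃ P', PropM ℓ m T' P' ∧ ∀ x ∈ T, P' x = P x := by
  classical
  induction hk : (T' \ T).ncard generalizing T P with
  | zero =>
    rw [Set.ncard_eq_zero (Set.toFinite _), Set.sdiff_eq_empty] at hk
    obtain rfl := Set.Subset.antisymm hT hk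
    exact ⟨P, hP, fun _ _ => rfl⟩
  | succ k ih =>
    obtain ⟨z, hz⟩ := Set.nonempty_of_ncard_ne_zero (s := T' \ T) (by omega)
    obtain ⟨col, h1, h2, -⟩ := valid_card T P z (h6 z) ∅ (by simp)
    obtain ⟨P1, hP1, -, hag⟩ := hP.ins hm hm' z hz.2 col h1 h2
    obtain ⟨P2, hP2, hag2⟩ := ih (insert z T) (Set.insert_subset hz.1 hT) P1 hP1 (by
      have : T' \ insert z T = (T' \ T) \ {z} := by ext; simp; tauto
      rw [this, Set.ncard_sdiff_singleton_of_mem hz]; omega)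
    exact ⟨P2, hP2, fun x hx => by rw [hag2 x (Set.mem_insert_of_mem _ hx), hag x hx]⟩

/-- invariant -/
structure StInv {V : Type*} (H : SimpleGraph V) (ℓ : V → V → Finset ℕ) (m : V → V) (v : V)
    (S : Set V) (P : V → ℕ) : Prop where
  mem : v ∈ S
  closed : ∀ x ∈ S, ∀ y, H.Adj x y → y ∈ S
  prop : PropM ℓ m S P
  good : ∀ x ∈ S, x ≠ v → ∃ n c, Cyc H n c ∧ (∃ i, c i = x) ∧
    ∀ Q : V → ℕ, (∀ x ∈ S, Q x = P x) → Surp ℓ m Q n c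

theorem StInv.step {V : Type*} [Fintype V] {H : SimpleGraph V} {ℓ : V → V → Finset ℕ} {m : V → V}
    {v : V} {S : Set V} {P : V → ℕ} (hI : StInv H ℓ m v S P)
    (hm : ∀ x, m (m x) = x) (hm' : ∀ x, m x ≠ x) (h6 : ∀ z, (ℓ z (m z)).card = 6)
    (h6' : ∀ x y, H.Adj x y → (ℓ x y).card = 6) (hH : H.IsCycles)
    (hN : ∀ x, x ≠ v → (H.neighborSet x).Nonempty) (y : V) (hy : y ∉ S) (hmy : m y ∈ S)
    (c0 : ℕ) (hc0 : c0 ∈ ℓ y (m y)) (hc0' : c0 ≠ P (m y)) :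
    ∃ S' P', StInv H ℓ m v S' P' ∧ S ⊆ S' ∧ y ∈ S' ∧ P' y = c0 ∧ ∀ x ∈ S, P' x = P x := by
  classical
  have hyv : y ≠ v := fun h => hy (h ▸ hI.mem)
  obtain ⟨n, c, hc, hc0y⟩ := exists_cyc H hH y (hN y hyv)
  have hn := hc.three
  have hcS : ∀ i, c i ∉ S := by
    intro i
    induction i with
    | zero => rw [hc0y]; exact hy
    | succ i ih => exact fun h => ih (hI.closed _ h _ (hc.adj i).symm)
  have hlast : H.Adj (c 0) (c (n - 1)) := by
    have := (hc.adj (n - 1)).symm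
    rwa [hc.eq_mod (i := n - 1 + 1) (j := 0) (by rw [show n - 1 + 1 = n by omega]; simp)] at this
  have cne : ∀ i < n, ∀ j < n, i ≠ j → c i ≠ c j := fun i hi j hj h h' => h (hc.inj i hi j hj h')
  -- base vertex
  obtain ⟨P1, hP1, P1y, ag1⟩ := hI.prop.ins hm hm' (c 0) (hcS 0) c0 (by rwa [hc0y])
    (fun _ => by rwa [hc0y])
  set T1 := insert (c 0) S with hT1
  have m01 : c 0 ∈ T1 := Set.mem_insert _ _
  have mm01 : m (c 0) ∈ T1 := Set.mem_insert_of_mem _ (by rwa [hc0y])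
  -- next vertex
  obtain ⟨col1, v1, w1, r1⟩ := sur1 T1 P1 (c 0) (c 1) m01 mm01 (h6 _) (h6' _ _ (hc.adj 0))
  have n1 : c 1 ∉ T1 := by
    rintro (h | h)
    · exact cne 1 (by omega) 0 (by omega) (by omega) h
    · exact hcS 1 h
  obtain ⟨P2, hP2, P2y, ag2⟩ := hP1.ins hm hm' (c 1) n1 col1 v1 w1
  set T2 := insert (c 1) T1 with hT2
  have s12 : T1 ⊆ T2 := Set.subset_insert _ _
  -- previous vertex
  obtain ⟨col2, v2, w2, r2⟩ := sur1 T2 P2 (c 0) (c (n - 1)) (s12 m01) (s12 mm01) (h6 _)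
    (h6' _ _ hlast)
  have n2 : c (n - 1) ∉ T2 := by
    rintro (h | h | h)
    · exact cne (n - 1) (by omega) 1 (by omega) (by omega) h
    · exact cne (n - 1) (by omega) 0 (by omega) (by omega) h
    · exact hcS _ h
  obtain ⟨P3, hP3, P3y, ag3⟩ := hP2.ins hm hm' (c (n - 1)) n2 col2 v2 w2
  set T3 := insert (c (n - 1)) T2 with hT3
  have s23 : T2 ⊆ T3 := Set.subset_insert _ _
  -- third vertex
  obtain ⟨T4, P4, s34, hP4, ag4, hT4, r4⟩ : ∃ (T4 : Set V) (P4 : V → ℕ), T3 ⊆ T4 ∧ PropM ℓ m T4 P4 ∧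
      (∀ x ∈ T3, P4 x = P3 x) ∧ T4 ⊆ S ∪ Set.range c ∧
      ∀ Q : V → ℕ, (∀ x ∈ T4, Q x = P4 x) → 4 ≤ n → 4 ≤ (lam ℓ m Q (c 2) (c 1)).card := by
    have hT3s : T3 ⊆ S ∪ Set.range c := by
      rintro x (rfl | rfl | rfl | h)
      · exact Or.inr ⟨_, rfl⟩
      · exact Or.inr ⟨_, rfl⟩
      · exact Or.inr ⟨_, rfl⟩
      · exact Or.inl h
    by_cases h4 : 4 ≤ n
    · obtain ⟨col3, v3, w3, r3⟩ := sur2 T3 P3 (c 2) (c 1) (s23 (Set.mem_insert _ _)) (h6 _)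
        (h6' _ _ (hc.adj 1).symm)
      have n3 : c 2 ∉ T3 := by
        rintro (h | h | h | h)
        · exact cne 2 (by omega) (n - 1) (by omega) (by omega) h
        · exact cne 2 (by omega) 1 (by omega) (by omega) h
        · exact cne 2 (by omega) 0 (by omega) (by omega) h
        · exact hcS _ h
      obtain ⟨P4, hP4, P4y, ag4⟩ := hP3.ins hm hm' (c 2) n3 col3 v3 w3
      refine ⟨insert (c 2) T3, P4, Set.subset_insert _ _, hP4, ag4, 
        Set.insert_subset (Or.inr ⟨_, rfl⟩) hT3s, fun Q hQ _ => r3 Q ?_ ?_⟩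
      · intro x hx; rw [hQ x (Set.mem_insert_of_mem _ hx), ag4 x hx]
      · rw [hQ _ (Set.mem_insert _ _), P4y]
    · exact ⟨T3, P3, subset_rfl, hP3, fun _ _ => rfl, hT3s, fun Q _ h => absurd h h4⟩
  obtain ⟨P5, hP5, ag5⟩ := hP4.extend hm hm' h6 T4 (S ∪ Set.range c) hT4
  have s45 := hT4
  have A4 : ∀ Q : V → ℕ, (∀ x ∈ S ∪ Set.range c, Q x = P5 x) → ∀ x ∈ T4, Q x = P4 x := 
    fun Q hQ x hx => by rw [hQ x (s45 hx), ag5 x hx]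
  have A3 : ∀ Q : V → ℕ, (∀ x ∈ S ∪ Set.range c, Q x = P5 x) → ∀ x ∈ T3, Q x = P3 x := 
    fun Q hQ x hx => by rw [A4 Q hQ x (s34 hx), ag4 x hx]
  have A2 : ∀ Q : V → ℕ, (∀ x ∈ S ∪ Set.range c, Q x = P5 x) → ∀ x ∈ T2, Q x = P2 x := 
    fun Q hQ x hx => by rw [A3 Q hQ x (s23 hx), ag3 x hx]
  have A1 : ∀ Q : V → ℕ, (∀ x ∈ S ∪ Set.range c, Q x = P5 x) → ∀ x ∈ T1, Q x = P1 x := 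
    fun Q hQ x hx => by rw [A2 Q hQ x (s12 hx), ag2 x hx]
  have A0 : ∀ Q : V → ℕ, (∀ x ∈ S ∪ Set.range c, Q x = P5 x) → ∀ x ∈ S, Q x = P x := 
    fun Q hQ x hx => by rw [A1 Q hQ x (Set.mem_insert_of_mem _ hx), ag1 x hx]
  refine ⟨S ∪ Set.range c, P5, ⟨Or.inl hI.mem, ?_, hP5, ?_⟩, Set.subset_union_left,
    Or.inr ⟨0, hc0y⟩, ?_, A0 P5 (fun _ _ => rfl)⟩
  · rintro x (hx | ⟨i, rfl⟩) w hw
    · exact Or.inl (hI.closed x hx w hw)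
    · rcases hc.nbr i w hw with rfl | rfl
      · exact Or.inr ⟨_, rfl⟩
      · exact Or.inr ⟨_, rfl⟩
  · rintro x (hx | ⟨i, rfl⟩) hxv
    · obtain ⟨n', c', h1, h2, h3⟩ := hI.good x hx hxv
      exact ⟨n', c', h1, h2, fun Q hQ => h3 Q (A0 Q hQ)⟩
    · refine ⟨n, c, hc, ⟨i, rfl⟩, fun Q hQ => ⟨r2 Q (A2 Q hQ) ?_, r1 Q (A1 Q hQ) ?_, r4 Q (A4 Q hQ)⟩⟩
      · rw [A3 Q hQ _ (Set.mem_insert _ _), P3y]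
      · rw [A2 Q hQ _ (Set.mem_insert _ _), P2y]
  · rw [← hc0y, A1 P5 (fun _ _ => rfl) _ m01, P1y]

theorem StInv.full {V : Type*} [Fintype V] {H : SimpleGraph V} {ℓ : V → V → Finset ℕ} {m : V → V}
    {v : V} {S : Set V} {P : V → ℕ} (hI : StInv H ℓ m v S P) (G : SimpleGraph V) (hG : G.Connected)
    (hGH : ∀ x y, G.Adj x y → H.Adj x y ∨ y = m x)
    (hm : ∀ x, m (m x) = x) (hm' : ∀ x, m x ≠ x) (h6 : ∀ z, (ℓ z (m z)).card = 6)
    (h6' : ∀ x y, H.Adj x y → (ℓ x y).card = 6) (hH : H.IsCycles)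
    (hN : ∀ x, x ≠ v → (H.neighborSet x).Nonempty) :
    ∃ P', StInv H ℓ m v Set.univ P' ∧ ∀ x ∈ S, P' x = P x := by
  induction hk : Sᶜ.ncard using Nat.strong_induction_on generalizing S P with
  | _ k ih =>
    by_cases hS : S = Set.univ
    · subst hS; exact ⟨P, hI, fun _ _ => rfl⟩
    obtain ⟨z, hz⟩ := (Set.ne_univ_iff_exists_notMem _).mp hS
    obtain ⟨p⟩ := hG.preconnected v z
    obtain ⟨d, -, hd1, hd2⟩ := p.exists_boundary_dart S hI.mem hz
    have hdm : d.snd = m d.fst := by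
      rcases hGH _ _ d.adj with h | h
      · exact absurd (hI.closed _ hd1 _ h) hd2
      · exact h
    have hmd : m d.snd = d.fst := by rw [hdm, hm]
    obtain ⟨col, h1, h2, -⟩ := valid_card S P d.snd (h6 _) ∅ (by simp)
    have hmS : m d.snd ∈ S := by rw [hmd]; exact hd1
    obtain ⟨S', P', hI', hSS', hy', -, hag⟩ := hI.step hm hm' h6 h6' hH hN d.snd hd2 hmS col h1 (h2 hmS)
    obtain ⟨P2, hP2, hag2⟩ := ih (S'ᶜ.ncard) (by
      rw [← hk]
      apply Set.ncard_lt_ncard _ (Set.toFinite _)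
      exact ⟨Set.compl_subset_compl.mpr hSS', fun h => h hd2 hy'⟩) hI' rfl
    exact ⟨P2, hP2, fun x hx => by rw [hag2 x (hSS' hx), hag x hx]⟩

theorem exists_arcs {V : Type*} [Fintype V] {H : SimpleGraph V} {ℓ : V → V → Finset ℕ} {m : V → V}
    {v : V} {P : V → ℕ} (hI : StInv H ℓ m v Set.univ P)
    (h6' : ∀ x y, H.Adj x y → (ℓ x y).card = 6) (hv : ∀ y, ¬ H.Adj v y) :
    ∃ ψ : V → V → ℕ, ∀ x y, H.Adj x y → ψ x y ∈ lam ℓ m P x y ∧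
      (∀ w, H.Adj x w → w ≠ y → ψ x w ≠ ψ x y) ∧ (∀ w, H.Adj y w → ψ x y ≠ ψ y w) := by
  classical
  have h3 : ∀ x y, H.Adj x y → 3 ≤ (lam ℓ m P x y).card := by
    intro x y h
    have h1 := Finset.le_card_sdiff {P x, P (m x), P y} (ℓ x y)
    have h2 : ({P x, P (m x), P y} : Finset ℕ).card ≤ 3 := Finset.card_le_three
    rw [h6' x y h] at h1
    rw [lam]; omega
  have hex : ∀ x, ∃ ψ : V → V → ℕ, x ≠ v → ∃ R : Set V, x ∈ R ∧ (∀ z ∈ R, ∀ y, H.Adj z y → y ∈ R) ∧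
      ∀ z ∈ R, ∀ y, H.Adj z y → ψ z y ∈ lam ℓ m P z y ∧
      (∀ w, H.Adj z w → w ≠ y → ψ z w ≠ ψ z y) ∧ (∀ w, H.Adj y w → ψ z y ≠ ψ y w) := by
    intro x
    by_cases hx : x = v
    · exact ⟨fun _ _ => 0, fun h => absurd hx h⟩
    obtain ⟨n, c, hc, hxc, hs⟩ := hI.good x trivial hx
    obtain ⟨s0, s1, s4⟩ := hs P (fun _ _ => rfl)
    obtain ⟨ψ, hψ⟩ := cyc_psi H n c hc (lam ℓ m P) h3 s0 s1 s4
    refine ⟨ψ, fun _ => ⟨Set.range c, hxc, ?_, ?_⟩⟩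
    · rintro _ ⟨i, rfl⟩ y hy
      rcases hc.nbr i y hy with rfl | rfl <;> exact ⟨_, rfl⟩
    · rintro _ ⟨i, rfl⟩ y hy
      exact hψ i y hy
  choose Ψ hΨ using hex
  let rep : V → V := fun x => (H.connectedComponentMk x).out
  have hrep : ∀ x y, H.Adj x y → rep x = rep y := by
    intro x y h
    simp only [rep]
    rw [SimpleGraph.ConnectedComponent.sound h.reachable]
  have hreach : ∀ x, H.Reachable (rep x) x := by
    intro x
    exact SimpleGraph.ConnectedComponent.exact (Quot.out_eq (H.connectedComponentMk x))
  refine ⟨fun x y => Ψ (rep x) x y, ?_⟩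
  intro x y hxy
  have hrv : rep x ≠ v := by
    intro h
    have hr := hreach x
    rw [h] at hr
    by_cases hvx : v = x
    · exact hv y (by rw [hvx]; exact hxy)
    · obtain ⟨p⟩ := hr
      obtain ⟨d, -, hd1, -⟩ := p.exists_boundary_dart {v} rfl (fun h => hvx h.symm)
      have hd : d.fst = v := hd1
      exact hv d.snd (by rw [← hd]; exact d.adj)
  obtain ⟨R, h1, h2, h3⟩ := hΨ (rep x) hrv
  have hxR : x ∈ R := by
    by_contra hn
    obtain ⟨p⟩ := hreach x
    obtain ⟨d, -, hd1, hd2⟩ := p.exists_boundary_dart R h1 hn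
    exact hd2 (h2 _ hd1 _ d.adj)
  have := h3 x hxR y hxy
  refine ⟨this.1, this.2.1, ?_⟩
  intro w hw
  dsimp only
  rw [← hrep x y hxy]
  exact this.2.2 w hw

theorem inc_ncard {V : Type*} (E : Set (Sym2 V)) (x : V) :
    {e | e ∈ E ∧ x ∈ e}.ncard = {y | s(x, y) ∈ E}.ncard := by
  have : {e | e ∈ E ∧ x ∈ e} = (fun y => s(x, y)) '' {y | s(x, y) ∈ E} := by
    ext e
    constructor
    · rintro ⟨he, y, rfl⟩
      exact ⟨y, he, rfl⟩
    · rintro ⟨y, hy, rfl⟩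
      exact ⟨hy, Sym2.mem_mk_left _ _⟩
  rw [this, Set.ncard_image_of_injective]
  intro a b h
  exact Sym2.congr_right.mp h

/-- Let `G` be a connected almost cubic simple graph (all vertices have degree 3 except at
most one) admitting a (1,2)-decomposition, and let `L` be an incidence 6-list assignment of
`G`. Then every pendent edge of `G` (an edge incident with a vertex of degree 1) is freely
`L`-choosable. -/
theorem pendent_edge_freely_choosable_of_almost_cubic {V : Type*} [Fintype V]
    (G : SimpleGraph V)
    (hconn : G.Connected)
    (halmost : ∀ u w : V, vdeg G u ≠ 3 → vdeg G w ≠ 3 → u = w)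
    (hdecomp : ∃ E₁ E₂ : Set (Sym2 V), IsOneTwoDecomposition G E₁ E₂)
    (L : V × Sym2 V → Finset ℕ)
    (hL : ∀ v e, IsIncidence G v e → (L (v, e)).card = 6) :
    ∀ u v, G.Adj u v → vdeg G v = 1 → FreelyLChoosable G L u v := by
  classical
  intro u v huv hv1 c₁ hc₁ c₂ hc₂ hne
  obtain ⟨E₁, E₂, hun, hdis, hE1, hE2⟩ := hdecomp
  have hE : ∀ x y, G.Adj x y ↔ s(x, y) ∈ E₁ ∨ s(x, y) ∈ E₂ := by
    intro x y
    rw [← SimpleGraph.mem_edgeSet, ← hun]; rfl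
  simp only [inc_ncard] at hE1 hE2
  have hdeg : ∀ x, vdeg G x = 1 + {y | s(x, y) ∈ E₂}.ncard := by
    intro x
    rw [vdeg, ← hE1 x, ← Set.ncard_union_eq _ (Set.toFinite _) (Set.toFinite _)]
    · congr 1
      ext y
      exact hE x y
    · rw [Set.disjoint_left]
      intro y h1 h2
      exact Set.disjoint_left.mp hdis h1 h2
  have hm0 : ∀ x, ∃ a, {y | s(x, y) ∈ E₁} = {a} := fun x => Set.ncard_eq_one.mp (hE1 x)
  choose m hmS using hm0
  have hmE : ∀ x y, s(x, y) ∈ E₁ ↔ y = m x := by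
    intro x y
    have : y ∈ {y | s(x, y) ∈ E₁} ↔ y ∈ ({m x} : Set V) := by rw [hmS x]
    simpa using this
  have hmG : ∀ x, G.Adj x (m x) := fun x => (hE _ _).mpr (Or.inl ((hmE _ _).mpr rfl))
  have hm : ∀ x, m (m x) = x := by
    intro x
    refine ((hmE (m x) x).mp ?_).symm
    rw [Sym2.eq_swap]
    exact (hmE _ _).mpr rfl
  have hm' : ∀ x, m x ≠ x := fun x h => (hmG x).ne h.symm
  let H : SimpleGraph V := SimpleGraph.fromEdgeSet E₂
  have hHadj : ∀ x y, H.Adj x y ↔ s(x, y) ∈ E₂ := by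
    intro x y
    simp only [H, SimpleGraph.fromEdgeSet_adj]
    exact ⟨fun h => h.1, fun h => ⟨h, ((hE x y).mpr (Or.inr h)).ne⟩⟩
  have hHG : ∀ x y, H.Adj x y → G.Adj x y := fun x y h => (hE x y).mpr (Or.inr ((hHadj x y).mp h))
  have hHm : ∀ x y, H.Adj x y → y ≠ m x := fun x y h h' =>
    Set.disjoint_left.mp hdis ((hmE x y).mpr h') ((hHadj x y).mp h)
  have hHn : ∀ x, H.neighborSet x = {y | s(x, y) ∈ E₂} := by
    intro x; ext y; exact hHadj x y
  have hGH : ∀ x y, G.Adj x y → H.Adj x y ∨ y = m x := by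
    intro x y h
    rcases (hE x y).mp h with h | h
    · exact Or.inr ((hmE _ _).mp h)
    · exact Or.inl ((hHadj _ _).mpr h)
  have hcyc : H.IsCycles := by
    intro x hx
    rw [hHn] at hx ⊢
    rcases hE2 x with h | h
    · rw [Set.ncard_eq_zero (Set.toFinite _)] at h
      rw [h] at hx; exact absurd hx Set.not_nonempty_empty
    · exact h
  have hN : ∀ x, x ≠ v → (H.neighborSet x).Nonempty := by
    intro x hx
    have h3 : vdeg G x = 3 := by
      by_contra h
      exact hx (halmost x v h (by omega))
    rw [hHn]
    apply Set.nonempty_of_ncard_ne_zero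
    have := hdeg x; omega
  have hvH : ∀ y, ¬ H.Adj v y := by
    intro y hy
    have h0 : {y | s(v, y) ∈ E₂}.ncard = 0 := by have := hdeg v; omega
    rw [Set.ncard_eq_zero (Set.toFinite _)] at h0
    have : y ∈ {y | s(v, y) ∈ E₂} := (hHadj v y).mp hy
    rw [h0] at this; exact this
  have hum : u = m v := by
    rcases hGH v u huv.symm with h | h
    · exact absurd h (hvH u)
    · exact h
  have hmu : m u = v := by rw [hum, hm]
  let ℓ : V → V → Finset ℕ := fun x y => L (x, s(x, y))
  have hl : ∀ x y, G.Adj x y → (ℓ x y).card = 6 := fun x y h =>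
    hL _ _ ⟨h, Sym2.mem_mk_left _ _⟩
  have h6 : ∀ z, (ℓ z (m z)).card = 6 := fun z => hl _ _ (hmG z)
  have h6' : ∀ x y, H.Adj x y → (ℓ x y).card = 6 := fun x y h => hl _ _ (hHG _ _ h)
  have hI0 : StInv H ℓ m v {v} (fun _ => c₂) := by
    refine ⟨rfl, ?_, ⟨?_, ?_⟩, ?_⟩
    · rintro x rfl y h; exact absurd h (hvH y)
    · rintro x rfl
      rw [← hum]
      simp only [ℓ]
      rw [Sym2.eq_swap]; exact hc₂
    · rintro x rfl h; exact absurd h (hm' _)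
    · rintro x rfl h; exact absurd rfl h
  obtain ⟨S1, P1, hI1, hS1, hu1, hPu, hag1⟩ := hI0.step hm hm' h6 h6' hcyc hN u
    (fun h => huv.ne h) (by rw [hmu]; rfl) c₁ (by rw [hmu]; exact hc₁) hne
  obtain ⟨P, hI, hag⟩ := hI1.full G hconn hGH hm hm' h6 h6' hcyc hN
  have hPu' : P u = c₁ := by rw [hag u hu1, hPu]
  have hPv' : P v = c₂ := by rw [hag v (hS1 rfl), hag1 v rfl]
  obtain ⟨ψ, hψ⟩ := exists_arcs hI h6' hvH
  let χ : V → V → ℕ := fun x y => if y = m x then P x else ψ x y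
  have χm : ∀ x, χ x (m x) = P x := fun x => if_pos rfl
  have χH : ∀ x y, H.Adj x y → χ x y = ψ x y := fun x y h => if_neg (hHm x y h)
  have hlam : ∀ x y, H.Adj x y → ψ x y ∈ ℓ x y ∧ ψ x y ≠ P x ∧ ψ x y ≠ P (m x) ∧ ψ x y ≠ P y := by
    intro x y h
    have := (hψ x y h).1
    simpa [lam] using this
  have hχl : ∀ x y, G.Adj x y → χ x y ∈ ℓ x y := by
    intro x y h
    rcases hGH x y h with h | rfl
    · rw [χH x y h]; exact (hlam x y h).1
    · rw [χm]; exact hI.prop.1 x trivial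
  have hχ1 : ∀ x y w, G.Adj x y → G.Adj x w → y ≠ w → χ x y ≠ χ x w := by
    intro x y w h h' hyw
    rcases hGH x y h with h | rfl <;> rcases hGH x w h' with h' | rfl
    · rw [χH x y h, χH x w h']; exact (hψ x w h').2.1 y h hyw
    · rw [χH x y h, χm]; exact (hlam x y h).2.1
    · rw [χH x w h', χm]; exact (hlam x w h').2.1.symm
    · exact absurd rfl hyw
  have hχ2 : ∀ x y w, G.Adj x y → G.Adj y w → χ x y ≠ χ y w := by
    intro x y w h h'
    rcases hGH x y h with h | rfl <;> rcases hGH _ w h' with h' | rfl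
    · rw [χH x y h, χH y w h']; exact (hψ x y h).2.2 w h'
    · rw [χH x y h, χm]; exact (hlam x y h).2.2.2
    · rw [χH _ w h', χm]
      have := (hlam _ w h').2.2.1.symm
      rwa [hm] at this
    · rw [χm, χm]; exact hI.prop.2 x trivial trivial
  let φ : V × Sym2 V → ℕ := fun q => if h : q.1 ∈ q.2 then χ q.1 (Sym2.Mem.other h) else 0
  have hφ : ∀ x y, φ (x, s(x, y)) = χ x y := by
    intro x y
    have hmem : x ∈ s(x, y) := Sym2.mem_mk_left _ _
    simp only [φ]
    rw [dif_pos hmem]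
    congr 1
    exact Sym2.congr_right.mp (Sym2.other_spec hmem)
  refine ⟨φ, ⟨?_, ?_⟩, ?_, ?_⟩
  · rintro x e ⟨he, y, rfl⟩
    rw [hφ]; exact hχl x y he
  · rintro x e z f ⟨he, y, rfl⟩ ⟨hf, w, rfl⟩ hneq hadj
    rw [hφ, hφ]
    rw [SimpleGraph.mem_edgeSet] at he hf
    by_cases hxz : x = z
    · subst hxz
      exact hχ1 x y w he hf (fun h => hneq (by rw [h]))
    · rcases hadj with h | h | h | h
      · exact absurd h hxz
      · rw [Sym2.eq_iff] at h
        rcases h with ⟨h, _⟩ | ⟨h1, h2⟩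
        · exact absurd h hxz
        · subst h1; subst h2
          exact hχ2 _ _ _ he hf
      · obtain rfl := Sym2.congr_right.mp h
        exact hχ2 _ _ _ he hf
      · rw [Sym2.eq_swap] at h
        obtain rfl := Sym2.congr_right.mp h
        exact (hχ2 _ _ _ hf he).symm
  · rw [hφ]
    have := χm u
    rwa [hmu, hPu'] at this
  · rw [Sym2.eq_swap, hφ]
    have := χm v
    rwa [← hum, hPv'] at this
end

section
/- Every 2-connected cubic simple graph admits a (1,2)-decomposition: its edge set can be partitioned into a perfect matching and a spanning 2-regular subgraph. -/
/-- A graph is 2-connected if it has at least 3 vertices, is connected, and deleting any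
single vertex leaves it connected. -/
def TwoConnected {W : Type*} (H : SimpleGraph W) : Prop :=
  H.Connected ∧ 3 ≤ Nat.card W ∧ ∀ w : W, (H.induce {x | x ≠ w}).Connected

open Classical in
/-- number of adjacent ordered pairs -/
noncomputable def eCount {V : Type*} (G : SimpleGraph V) (A B : Finset V) : ℕ :=
  ∑ v ∈ A, ∑ w ∈ B, if G.Adj v w then 1 else 0

lemma eCount_comm {V : Type*} (G : SimpleGraph V) (A B : Finset V) :
    eCount G A B = eCount G B A := by
  unfold eCount
  rw [Finset.sum_comm]
  refine Finset.sum_congr rfl fun v _ => Finset.sum_congr rfl fun w _ => ?_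
  by_cases h : G.Adj v w
  · simp [h, h.symm]
  · simp only [h, if_false, ite_eq_right_iff]
    exact fun h2 => absurd h2.symm h

open Classical in
lemma eCount_card {V : Type*} (G : SimpleGraph V) (A B : Finset V) :
    eCount G A B = ((A ×ˢ B).filter (fun p => G.Adj p.1 p.2)).card := by
  rw [Finset.card_filter, Finset.sum_product]
  rfl

lemma eCount_self_even {V : Type*} (G : SimpleGraph V) (A : Finset V) :
    Even (eCount G A A) := by
  classical
  rw [eCount_card, ← ZMod.natCast_eq_zero_iff_even, Finset.cast_card]
  refine Finset.sum_involution (fun p _ => (p.2, p.1)) ?_ ?_ ?_ ?_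
  · intro p hp
    decide
  · intro p hp _ h
    simp only [Finset.mem_filter] at hp
    have := congrArg Prod.fst h
    simp only at this
    exact hp.2.ne this.symm
  · intro p hp
    simp only [Finset.mem_filter, Finset.mem_product] at hp ⊢
    exact ⟨⟨hp.1.2, hp.1.1⟩, hp.2.symm⟩
  · intro p hp
    rfl

lemma eCount_deg {V : Type*} [Fintype V] (G : SimpleGraph V) (hcubic : ∀ v, vdeg G v = 3) (v : V) :
    eCount G {v} Finset.univ = 3 := by
  classical
  rw [← hcubic v]
  unfold eCount vdeg
  rw [Finset.sum_singleton, ← Finset.card_filter, ← Set.ncard_coe_finset]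
  congr 1
  ext w
  simp

lemma eCount_univ {V : Type*} [Fintype V] (G : SimpleGraph V) (hcubic : ∀ v, vdeg G v = 3)
    (A : Finset V) : eCount G A Finset.univ = 3 * A.card := by
  have h := fun v => eCount_deg G hcubic v
  unfold eCount at *
  simp only [Finset.sum_singleton] at h
  simp only [h, Finset.sum_const, smul_eq_mul, mul_comm]

open Classical in
lemma eCount_compl {V : Type*} [Fintype V] (G : SimpleGraph V)
    (A B : Finset V) : eCount G A B + eCount G A Bᶜ = eCount G A Finset.univ := by
  unfold eCount
  rw [← Finset.sum_add_distrib]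
  refine Finset.sum_congr rfl fun v _ => ?_
  exact Finset.sum_add_sum_compl B _

open Classical in
lemma cut_ge_three {V : Type*} [Fintype V] (G : SimpleGraph V) (hcubic : ∀ v, vdeg G v = 3)
    (h2 : TwoConnected G) (C : Finset V) (hC : Odd C.card) : 3 ≤ eCount G C Cᶜ := by
  have h1 := eCount_compl G C C
  rw [eCount_univ G hcubic] at h1
  obtain ⟨a, ha⟩ := eCount_self_even G C
  obtain ⟨b, hb⟩ := hC
  have hne : eCount G C Cᶜ ≠ 1 := by
    intro h
    rw [eCount_card, Finset.card_eq_one] at h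
    obtain ⟨⟨c, s⟩, hcs⟩ := h
    have key : ∀ x y, x ∈ C → y ∉ C → G.Adj x y → x = c ∧ y = s := by
      intro x y hx hy hxy
      have : (x, y) ∈ ({(c, s)} : Finset (V × V)) := by
        rw [← hcs]; simp [hx, hy, hxy]
      simpa using this
    have hm : (c, s) ∈ (C ×ˢ Cᶜ).filter (fun p => G.Adj p.1 p.2) := by
      rw [hcs]; simp
    simp only [Finset.mem_filter, Finset.mem_product, Finset.mem_compl] at hm
    obtain ⟨⟨hc, hs⟩, hadj⟩ := hm
    have : ∃ c', c' ∈ C ∧ G.Adj c c' := by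
      by_contra hcon
      push Not at hcon
      have h3 := hcubic c
      have : G.neighborSet c ⊆ {s} := by
        intro y hy
        by_cases hyC : y ∈ C
        · exact absurd hy (hcon y hyC)
        · exact (key c y hc hyC hy).2
      have := Set.ncard_le_ncard this
      rw [Set.ncard_singleton] at this
      unfold vdeg at h3
      omega
    obtain ⟨c', hc', hcc'⟩ := this
    have hconn := h2.2.2 c
    have hsc : s ≠ c := fun h => hs (h ▸ hc)
    obtain ⟨p⟩ := hconn.preconnected ⟨c', hcc'.ne'⟩ ⟨s, hsc⟩
    obtain ⟨d, -, hd1, hd2⟩ := p.exists_boundary_dart {x | x.1 ∈ C} hc' hs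
    have := key d.fst.1 d.snd.1 hd1 hd2 d.adj
    exact d.fst.2 this.1
  omega

lemma exists_pm {V : Type*} [Fintype V] (G : SimpleGraph V) (hcubic : ∀ v, vdeg G v = 3)
    (h2 : TwoConnected G) : ∃ M : G.Subgraph, M.IsPerfectMatching := by
  classical
  rw [SimpleGraph.tutte]
  intro u hu
  unfold SimpleGraph.IsTutteViolator at hu
  set H := ((⊤ : G.Subgraph).deleteVerts u).coe with hH
  let F : H.ConnectedComponent → Finset V := fun K =>
    Finset.univ.filter fun v => ∃ h, H.connectedComponentMk ⟨v, h⟩ = K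
  have hFcard : ∀ K, (F K).card = K.supp.ncard := by
    intro K
    rw [← Set.ncard_image_of_injective K.supp Subtype.val_injective, ← Set.ncard_coe_finset]
    congr 1
    ext v
    simp [F, SimpleGraph.ConnectedComponent.mem_supp_iff]
  have hFdisj : ∀ K L, K ≠ L → Disjoint (F K) (F L) := by
    intro K L hKL
    rw [Finset.disjoint_left]
    intro v hv hv'
    simp only [F, Finset.mem_filter, Finset.mem_univ, true_and] at hv hv'
    obtain ⟨_, h⟩ := hv
    obtain ⟨_, h'⟩ := hv'
    exact hKL (h.symm.trans h')
  have hcross : ∀ K, eCount G (F K) (F K)ᶜ ≤ eCount G (F K) u.toFinset := by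
    intro K
    rw [eCount_card, eCount_card]
    apply Finset.card_le_card
    rintro ⟨x, y⟩ hp
    simp only [Finset.mem_filter, Finset.mem_product, Finset.mem_compl, Set.mem_toFinset] at hp ⊢
    obtain ⟨⟨hx, hy⟩, hxy⟩ := hp
    refine ⟨⟨hx, ?_⟩, hxy⟩
    by_contra hyu
    apply hy
    simp only [F, Finset.mem_filter, Finset.mem_univ, true_and] at hx ⊢
    obtain ⟨hx1, hx2⟩ := hx
    refine ⟨⟨trivial, hyu⟩, ?_⟩
    rw [← hx2]
    apply SimpleGraph.ConnectedComponent.sound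
    apply SimpleGraph.Adj.reachable
    rw [hH, SimpleGraph.Subgraph.coe_adj, SimpleGraph.Subgraph.deleteVerts_adj]
    exact ⟨trivial, hyu, trivial, hx1.2, hxy.symm⟩
  let O : Finset H.ConnectedComponent := H.oddComponents.toFinset
  have hO : H.oddComponents.ncard = O.card := Set.ncard_eq_toFinset_card' _
  have hlow : 3 * O.card ≤ ∑ K ∈ O, eCount G (F K) u.toFinset := by
    rw [mul_comm, ← smul_eq_mul]
    refine Finset.card_nsmul_le_sum _ _ _ fun K hK => ?_
    refine le_trans (cut_ge_three G hcubic h2 (F K) ?_) (hcross K)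
    rw [hFcard]
    simpa [O] using hK
  have hup : ∑ K ∈ O, eCount G (F K) u.toFinset ≤ eCount G Finset.univ u.toFinset := by
    unfold eCount
    rw [← Finset.sum_biUnion (fun K _ L _ h => hFdisj K L h)]
    exact Finset.sum_le_sum_of_subset (Finset.subset_univ _)
  rw [eCount_comm, eCount_univ G hcubic, ← Set.ncard_eq_toFinset_card'] at hup
  omega

/-- Every 2-connected cubic simple graph admits a (1,2)-decomposition: its edge set can be
partitioned into sets `E₁` and `E₂` such that every vertex lies on exactly one edge of `E₁`
(a perfect matching) and on exactly two edges of `E₂` (a spanning 2-regular subgraph). -/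
theorem oneTwoDecomposition_of_twoConnected_cubic {V : Type*} [Fintype V]
    (G : SimpleGraph V) (hcubic : ∀ v, vdeg G v = 3) (h2 : TwoConnected G) :
    ∃ E₁ E₂ : Set (Sym2 V),
      E₁ ∪ E₂ = G.edgeSet ∧ Disjoint E₁ E₂ ∧
      (∀ v : V, {e | e ∈ E₁ ∧ v ∈ e}.ncard = 1) ∧
      (∀ v : V, {e | e ∈ E₂ ∧ v ∈ e}.ncard = 2) := by
  obtain ⟨M, hM⟩ := exists_pm G hcubic h2
  rw [SimpleGraph.Subgraph.isPerfectMatching_iff] at hM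
  have hinc : ∀ (v : V) (P : V → Prop) (S : Set (Sym2 V)),
      (∀ w, s(v, w) ∈ S ↔ P w) → {e | e ∈ S ∧ v ∈ e}.ncard = {w | P w}.ncard := by
    intro v P S h
    have : {e | e ∈ S ∧ v ∈ e} = (fun w => s(v, w)) '' {w | P w} := by
      ext e
      constructor
      · rintro ⟨he, hv⟩
        obtain ⟨w, rfl⟩ := Sym2.mem_iff_exists.1 hv
        exact ⟨w, (h w).1 he, rfl⟩
      · rintro ⟨w, hw, rfl⟩
        exact ⟨(h w).2 hw, Sym2.mem_mk_left _ _⟩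
    rw [this]
    exact Set.ncard_image_of_injective _ fun a b hab => Sym2.congr_right.1 hab
  have h1 : ∀ v, {w | M.Adj v w}.ncard = 1 := by
    intro v
    obtain ⟨w, hw, huniq⟩ := hM v
    rw [Set.ncard_eq_one]
    exact ⟨w, Set.ext fun x => ⟨fun hx => huniq x hx, fun hx => by
      rw [Set.mem_singleton_iff] at hx; subst hx; exact hw⟩⟩
  refine ⟨M.edgeSet, G.edgeSet \ M.edgeSet, Set.union_sdiff_cancel M.edgeSet_subset,
    Set.disjoint_sdiff_right, ?_, ?_⟩
  · intro v
    rw [hinc v (fun w => M.Adj v w) _ (fun w => SimpleGraph.Subgraph.mem_edgeSet), h1]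
  · intro v
    rw [hinc v (fun w => G.Adj v w ∧ ¬ M.Adj v w) _ (fun w => by simp)]
    have h3 := hcubic v
    unfold vdeg at h3
    have hsub : {w | M.Adj v w} ⊆ G.neighborSet v := fun w hw => hw.adj_sub
    have := Set.ncard_sdiff hsub
    rw [h3, h1] at this
    exact this
end
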